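/- Let (δ_n) be a real sequence, (γ_n) strictly positive, and (σ_n) strictly positive. If the infinite product measures ⊗_{n∈ℕ} μ(δ_n, γ_n) and ⊗_{n∈ℕ} μ(δ_n, σ_n γ_n) on ℝ^ℕ are mutually absolutely continuous, then ∑_n (σ_n − 1)² < ∞. -/

import Mathlib

open MeasureTheory Real

/-- The Cauchy measure on `ℝ` with location parameter `δ` and scale parameter `γ`. -/
noncomputable def cauchyMeasure (δ γ : ℝ) : Measure ℝ :=
  volume.withDensity fun x => ENNReal.ofReal (γ / (π * ((x - δ) ^ 2 + γ ^ 2)))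

open Filter Topology

/-- Chebyshev's inequality for a weighted sum of independent `[0, 1]`-valued observables under a
product measure. -/
lemma infinitePi_weighted_sum_deviation_le {X : ℕ → Type*} [∀ n, MeasurableSpace (X n)]
    (μ : ∀ n, Measure (X n)) [∀ n, IsProbabilityMeasure (μ n)] {f : ∀ n, X n → ℝ}
    (hf : ∀ n, Measurable (f n)) (hf01 : ∀ n x, f n x ∈ Set.Icc (0 : ℝ) 1)
    (c : ℕ → ℝ) (s : Finset ℕ) (hc : 0 < ∑ i ∈ s, c i ^ 2) :
    Measure.infinitePi μ {ω | (∑ i ∈ s, c i ^ 2) / 2 ≤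
        |∑ i ∈ s, c i * f i (ω i) - ∑ i ∈ s, c i * ∫ x, f i x ∂(μ i)|} ≤
      ENNReal.ofReal (∑ i ∈ s, c i ^ 2)⁻¹ := by
  set A := ∑ i ∈ s, c i ^ 2 with hA
  set Y : ℕ → (∀ n, X n) → ℝ := fun i ω => c i * f i (ω i) with hY
  have hfm : ∀ i, Measurable fun ω : ∀ n, X n => f i (ω i) := fun i =>
    (hf i).comp (measurable_pi_apply i)
  have hfL : ∀ i, MemLp (fun ω : ∀ n, X n => f i (ω i)) 2 (Measure.infinitePi μ) := fun i =>
    memLp_of_bounded (ae_of_all _ fun ω : ∀ n, X n => hf01 i (ω i)) (hfm i).aestronglyMeasurable 2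
  have hYL : ∀ i, MemLp (Y i) 2 (Measure.infinitePi μ) := fun i => (hfL i).const_mul (c i)
  have hind : ProbabilityTheory.iIndepFun Y (Measure.infinitePi μ) :=
    ProbabilityTheory.iIndepFun_infinitePi (X := fun i x => c i * f i x) fun i =>
      (hf i).const_mul (c i)
  have hvar : ProbabilityTheory.variance (∑ i ∈ s, Y i) (Measure.infinitePi μ) ≤ A / 4 := by
    rw [ProbabilityTheory.IndepFun.variance_sum (fun i _ => hYL i) fun i _ j _ hij =>
      hind.indepFun hij, hA, Finset.sum_div]
    refine Finset.sum_le_sum fun i _ => ?_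
    have h := ProbabilityTheory.variance_le_sq_of_bounded (μ := Measure.infinitePi μ)
      (X := fun ω : ∀ n, X n => f i (ω i))
      (ae_of_all _ fun ω => hf01 i (ω i)) (hfm i).aemeasurable
    rw [hY, ProbabilityTheory.variance_const_mul]
    nlinarith [sq_nonneg (c i)]
  have hmean : ∫ ω, (∑ i ∈ s, Y i) ω ∂(Measure.infinitePi μ) =
      ∑ i ∈ s, c i * ∫ x, f i x ∂(μ i) := by
    simp only [Finset.sum_apply]
    rw [integral_finsetSum _ fun i _ => (hYL i).integrable (by norm_num)]
    refine Finset.sum_congr rfl fun i _ => ?_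
    rw [hY, integral_const_mul, ← (measurePreserving_eval_infinitePi μ i).map_eq,
      integral_map (measurable_pi_apply i).aemeasurable (hf i).aestronglyMeasurable]
  have h := ProbabilityTheory.meas_ge_le_variance_div_sq
    (memLp_finsetSum' s fun i _ => hYL i) (half_pos hc)
  rw [hmean] at h
  simp only [Finset.sum_apply] at h
  refine h.trans (ENNReal.ofReal_le_ofReal ?_)
  rw [div_le_iff₀ (by positivity)]
  refine hvar.trans (le_of_eq ?_)
  field_simp
  norm_num

/-- Absolute continuity of product measures forces the differences of the means of uniformly
bounded coordinate observables to be square summable. -/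
lemma summable_sq_integral_sub_of_infinitePi_absolutelyContinuous {X : ℕ → Type*}
    [∀ n, MeasurableSpace (X n)] (μ ν : ∀ n, Measure (X n)) [∀ n, IsProbabilityMeasure (μ n)]
    [∀ n, IsProbabilityMeasure (ν n)] (hac : Measure.infinitePi ν ≪ Measure.infinitePi μ)
    {f : ∀ n, X n → ℝ} (hf : ∀ n, Measurable (f n))
    (hf01 : ∀ n x, f n x ∈ Set.Icc (0 : ℝ) 1) :
    Summable fun n => (∫ x, f n x ∂(ν n) - ∫ x, f n x ∂(μ n)) ^ 2 := by
  set a : ℕ → ℝ := fun n => ∫ x, f n x ∂(ν n) - ∫ x, f n x ∂(μ n) with ha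
  by_contra hns
  have hA := (not_summable_iff_tendsto_nat_atTop_of_nonneg fun n => sq_nonneg (a n)).1 hns
  set A : ℕ → ℝ := fun n => ∑ i ∈ Finset.range n, a i ^ 2 with hA_def
  let E (ρ : ∀ n, Measure (X n)) (n : ℕ) : Set (∀ n, X n) := {ω | A n / 2 ≤
    |∑ i ∈ Finset.range n, a i * f i (ω i) - ∑ i ∈ Finset.range n, a i * ∫ x, f i x ∂(ρ i)|}
  have hlim : Tendsto (fun n => ENNReal.ofReal (A n)⁻¹) atTop (𝓝 0) := by
    simpa using ENNReal.tendsto_ofReal (tendsto_inv_atTop_zero.comp hA)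
  have hE (ρ : ∀ n, Measure (X n)) [∀ n, IsProbabilityMeasure (ρ n)] :
      Tendsto (fun n => Measure.infinitePi ρ (E ρ n)) atTop (𝓝 0) := by
    refine tendsto_of_tendsto_of_tendsto_of_le_of_le' tendsto_const_nhds hlim
      (Eventually.of_forall fun _ => zero_le) ?_
    filter_upwards [hA.eventually_gt_atTop 0] with n hn
    exact infinitePi_weighted_sum_deviation_le ρ hf hf01 a _ hn
  have hEμ : Tendsto (fun n => Measure.infinitePi ν (E μ n)) atTop (𝓝 0) := by
    have h := tendsto_setLIntegral_zero
      (Measure.lintegral_rnDeriv_lt_top (Measure.infinitePi ν) (Measure.infinitePi μ)).ne (hE μ)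
    simpa only [Measure.setLIntegral_rnDeriv hac] using h
  have hsum := hEμ.add (hE ν)
  rw [add_zero] at hsum
  obtain ⟨n, hn⟩ := (hsum.eventually (gt_mem_nhds (zero_lt_one' ENNReal))).exists
  have hcover : (Set.univ : Set (∀ n, X n)) ⊆ E μ n ∪ E ν n := by
    intro ω _
    by_contra hω
    simp only [E, Set.mem_union, Set.mem_ofPred_eq, not_or, not_le] at hω
    obtain ⟨h1, h2⟩ := hω
    have hdiff : A n = ∑ i ∈ Finset.range n, a i * ∫ x, f i x ∂(ν i) -
        ∑ i ∈ Finset.range n, a i * ∫ x, f i x ∂(μ i) := by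
      rw [← Finset.sum_sub_distrib]
      refine Finset.sum_congr rfl fun i _ => ?_
      rw [ha]
      ring
    linarith [(abs_lt.1 h1).2, (abs_lt.1 h2).1]
  have := (measure_mono hcover).trans (measure_union_le (μ := Measure.infinitePi ν) _ _)
  rw [measure_univ] at this
  exact absurd hn this.not_gt

lemma isProbabilityMeasure_cauchyMeasure (δ : ℝ) {γ : ℝ} (hγ : 0 < γ) :
    IsProbabilityMeasure (cauchyMeasure δ γ) := by
  lift γ to NNReal using hγ.le
  have hγ' : γ ≠ 0 := by
    rintro rfl
    simp at hγ
  have h : cauchyMeasure δ γ = ProbabilityTheory.cauchyMeasure δ γ := by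
    rw [ProbabilityTheory.cauchyMeasure_of_scale_ne_zero δ hγ', cauchyMeasure]
    congr 1
    ext x
    rw [ProbabilityTheory.cauchyPDF_def, ProbabilityTheory.cauchyPDFReal_def]
    congr 1
    have : (0 : ℝ) < (x - δ) ^ 2 + γ ^ 2 := by positivity
    field_simp
  rw [h]
  infer_instance

lemma integral_cauchyMeasure (δ : ℝ) {γ : ℝ} (hγ : 0 < γ) (f : ℝ → ℝ) :
    ∫ x, f x ∂(cauchyMeasure δ γ) = ∫ x, γ / (π * ((x - δ) ^ 2 + γ ^ 2)) * f x := by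
  rw [cauchyMeasure, integral_withDensity_eq_integral_toReal_smul (by fun_prop) (by simp)]
  refine integral_congr_ae (ae_of_all _ fun x => ?_)
  simp only [smul_eq_mul]
  rw [ENNReal.toReal_ofReal (by positivity)]

lemma integrable_and_integral_inv_sq_add_sq {a : ℝ} (ha : 0 < a) :
    Integrable (fun x : ℝ => (x ^ 2 + a ^ 2)⁻¹) ∧ ∫ x : ℝ, (x ^ 2 + a ^ 2)⁻¹ = π / a := by
  have h : (fun x : ℝ => (x ^ 2 + a ^ 2)⁻¹) = fun x => (a ^ 2)⁻¹ * (1 + (x / a) ^ 2)⁻¹ := by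
    ext x
    have : 0 < x ^ 2 + a ^ 2 := by positivity
    field_simp
    ring
  rw [h]
  refine ⟨(integrable_inv_one_add_sq.comp_div ha.ne').const_mul _, ?_⟩
  rw [integral_const_mul, Measure.integral_comp_div (fun x : ℝ => (1 + x ^ 2)⁻¹),
    integral_univ_inv_one_add_sq, abs_of_pos ha, smul_eq_mul]
  field_simp

lemma integral_inv_sq_add_sq_sq {a : ℝ} (ha : 0 < a) :
    ∫ x : ℝ, (x ^ 2 + a ^ 2)⁻¹ * (x ^ 2 + a ^ 2)⁻¹ = π / (2 * a ^ 3) := by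
  obtain ⟨hint, hval⟩ := integrable_and_integral_inv_sq_add_sq ha
  have hpos : ∀ x : ℝ, 0 < x ^ 2 + a ^ 2 := fun x => by positivity
  set g : ℝ → ℝ := fun x => (a ^ 2 - x ^ 2) * ((x ^ 2 + a ^ 2)⁻¹ * (x ^ 2 + a ^ 2)⁻¹) with hg
  have hcont : Continuous fun x : ℝ => (x ^ 2 + a ^ 2)⁻¹ :=
    Continuous.inv₀ (by fun_prop) fun x => (hpos x).ne'
  have hgint : Integrable g := by
    refine hint.mono (Continuous.aestronglyMeasurable (by fun_prop)) (ae_of_all _ fun x => ?_)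
    rw [hg, norm_mul, norm_mul, ← mul_assoc]
    refine mul_le_of_le_one_left (norm_nonneg _) ?_
    rw [norm_inv, Real.norm_eq_abs, Real.norm_eq_abs, abs_of_pos (hpos x), ← div_eq_mul_inv,
      div_le_one (hpos x), abs_le]
    constructor <;> nlinarith [sq_nonneg x, sq_nonneg a]
  have hbound : ∀ x : ℝ, |x * (x ^ 2 + a ^ 2)⁻¹| ≤ |x|⁻¹ := by
    intro x
    rcases eq_or_ne x 0 with rfl | hx
    · simp
    rw [abs_mul, abs_inv, abs_of_pos (hpos x), ← div_eq_mul_inv, div_le_iff₀ (hpos x),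
      inv_mul_eq_div, le_div_iff₀ (abs_pos.2 hx), abs_mul_abs_self]
    nlinarith
  have hbot : Tendsto (fun x : ℝ => x * (x ^ 2 + a ^ 2)⁻¹) atBot (𝓝 0) :=
    squeeze_zero_norm hbound (tendsto_inv_atTop_zero.comp tendsto_abs_atBot_atTop)
  have htop : Tendsto (fun x : ℝ => x * (x ^ 2 + a ^ 2)⁻¹) atTop (𝓝 0) :=
    squeeze_zero_norm hbound (tendsto_inv_atTop_zero.comp tendsto_abs_atTop_atTop)
  have hderiv : ∀ x : ℝ, HasDerivAt (fun x : ℝ => x * (x ^ 2 + a ^ 2)⁻¹) (g x) x := by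
    intro x
    have hsq : HasDerivAt (fun x : ℝ => x ^ 2 + a ^ 2) (2 * x) x := by
      simpa using (hasDerivAt_pow 2 x).add_const (a ^ 2)
    convert! (hasDerivAt_id' x).fun_mul (hsq.fun_inv (hpos x).ne') using 1
    have := (hpos x).ne'
    simp only [hg]
    field_simp
    ring
  have hg0 : ∫ x, g x = 0 := by
    simpa using integral_of_hasDerivAt_of_tendsto hderiv hgint hbot htop
  have hdecomp : (fun x : ℝ => (x ^ 2 + a ^ 2)⁻¹ * (x ^ 2 + a ^ 2)⁻¹) =
      fun x => (2 * a ^ 2)⁻¹ * (g x + (x ^ 2 + a ^ 2)⁻¹) := by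
    ext x
    have := (hpos x).ne'
    simp only [hg]
    field_simp
    ring
  rw [hdecomp, integral_const_mul, integral_add hgint hint, hg0, hval]
  field_simp
  ring

lemma integral_inv_sq_add_sq_mul_inv_sq_add_sq {a b : ℝ} (ha : 0 < a) (hb : 0 < b) :
    ∫ x : ℝ, (x ^ 2 + a ^ 2)⁻¹ * (x ^ 2 + b ^ 2)⁻¹ = π / (a * b * (a + b)) := by
  rcases eq_or_ne a b with rfl | hab
  · rw [integral_inv_sq_add_sq_sq ha]
    field_simp
    ring
  obtain ⟨hia, hva⟩ := integrable_and_integral_inv_sq_add_sq ha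
  obtain ⟨hib, hvb⟩ := integrable_and_integral_inv_sq_add_sq hb
  have hsub : b - a ≠ 0 := sub_ne_zero.2 hab.symm
  have hne : b ^ 2 - a ^ 2 ≠ 0 := by
    rw [sq_sub_sq]
    exact mul_ne_zero (by positivity) hsub
  have hdecomp : (fun x : ℝ => (x ^ 2 + a ^ 2)⁻¹ * (x ^ 2 + b ^ 2)⁻¹) =
      fun x => (b ^ 2 - a ^ 2)⁻¹ * ((x ^ 2 + a ^ 2)⁻¹ - (x ^ 2 + b ^ 2)⁻¹) := by
    ext x
    have h1 : x ^ 2 + a ^ 2 ≠ 0 := by positivity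
    have h2 : x ^ 2 + b ^ 2 ≠ 0 := by positivity
    field_simp
    ring
  rw [hdecomp, integral_const_mul, integral_sub hia hib, hva, hvb, sq_sub_sq]
  have hadd : b + a ≠ 0 := by positivity
  field_simp
  ring

lemma integral_cauchyMeasure_sq_div (δ : ℝ) {a b : ℝ} (ha : 0 < a) (hb : 0 < b) :
    ∫ x, b ^ 2 / ((x - δ) ^ 2 + b ^ 2) ∂(cauchyMeasure δ a) = b / (a + b) := by
  rw [integral_cauchyMeasure δ ha,
    integral_sub_right_eq_self
      (fun x : ℝ => a / (π * (x ^ 2 + a ^ 2)) * (b ^ 2 / (x ^ 2 + b ^ 2))) δ]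
  have h : (fun x : ℝ => a / (π * (x ^ 2 + a ^ 2)) * (b ^ 2 / (x ^ 2 + b ^ 2))) =
      fun x => a * b ^ 2 / π * ((x ^ 2 + a ^ 2)⁻¹ * (x ^ 2 + b ^ 2)⁻¹) := by
    ext x
    field_simp
  rw [h, integral_const_mul, integral_inv_sq_add_sq_mul_inv_sq_add_sq ha hb]
  field_simp

theorem cauchy_product_dilations_equivalent_implies_summable
    (δ γ σ : ℕ → ℝ) (hγ : ∀ n, 0 < γ n) (hσ : ∀ n, 0 < σ n)
    (P Q : Measure (ℕ → ℝ))
    (hP : IsProjectiveLimit P fun I : Finset ℕ =>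
      Measure.pi fun i : I => cauchyMeasure (δ i.1) (γ i.1))
    (hQ : IsProjectiveLimit Q fun I : Finset ℕ =>
      Measure.pi fun i : I => cauchyMeasure (δ i.1) (σ i.1 * γ i.1))
    (heq : P ≪ Q ∧ Q ≪ P) :
    Summable fun n => (σ n - 1) ^ 2 := by
  have hσγ : ∀ n, 0 < σ n * γ n := fun n => mul_pos (hσ n) (hγ n)
  have hμ : ∀ n, IsProbabilityMeasure (cauchyMeasure (δ n) (γ n)) := fun n =>
    isProbabilityMeasure_cauchyMeasure _ (hγ n)
  have hν : ∀ n, IsProbabilityMeasure (cauchyMeasure (δ n) (σ n * γ n)) := fun n =>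
    isProbabilityMeasure_cauchyMeasure _ (hσγ n)
  have hac : Measure.infinitePi (fun n => cauchyMeasure (δ n) (σ n * γ n)) ≪
      Measure.infinitePi (fun n => cauchyMeasure (δ n) (γ n)) := by
    rw [← hP.unique (Measure.isProjectiveLimit_infinitePi fun n => cauchyMeasure (δ n) (γ n)),
      ← hQ.unique
        (Measure.isProjectiveLimit_infinitePi fun n => cauchyMeasure (δ n) (σ n * γ n))]
    exact heq.2
  have hsum := summable_sq_integral_sub_of_infinitePi_absolutelyContinuous _ _ hac
    (f := fun n x => γ n ^ 2 / ((x - δ n) ^ 2 + γ n ^ 2)) (fun n => by fun_prop) fun n x => by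
      have := hγ n
      refine ⟨by positivity, (div_le_one (by positivity)).2 ?_⟩
      linarith [sq_nonneg (x - δ n)]
  have hval : ∀ n, ∫ x, γ n ^ 2 / ((x - δ n) ^ 2 + γ n ^ 2) ∂(cauchyMeasure (δ n) (σ n * γ n)) -
      ∫ x, γ n ^ 2 / ((x - δ n) ^ 2 + γ n ^ 2) ∂(cauchyMeasure (δ n) (γ n)) =
      1 / (1 + σ n) - 1 / 2 := by
    intro n
    rw [integral_cauchyMeasure_sq_div _ (hσγ n) (hγ n),
      integral_cauchyMeasure_sq_div _ (hγ n) (hγ n)]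
    have := hγ n
    have := hσ n
    field_simp
    ring
  simp only [hval] at hsum
  refine Summable.of_norm_bounded_eventually_nat (hsum.mul_left 64) ?_
  filter_upwards [hsum.tendsto_atTop_zero.eventually (gt_mem_nhds (show (0 : ℝ) < 1 / 16 by
    norm_num))] with n hn
  have hlow : 1 / 4 < 1 / (1 + σ n) := by
    have h : (1 / (1 + σ n) - 1 / 2) ^ 2 < (1 / 4) ^ 2 := hn.trans_eq (by norm_num)
    linarith [(abs_lt_of_sq_lt_sq' h (by norm_num)).1]
  have hσn := hσ n
  have hσ3 : 1 + σ n < 4 := (one_div_lt_one_div (by norm_num) (by linarith)).1 hlow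
  have hkey : σ n - 1 = -(2 * (1 + σ n)) * (1 / (1 + σ n) - 1 / 2) := by
    field_simp
    ring
  rw [Real.norm_of_nonneg (sq_nonneg _), hkey, mul_pow]
  exact mul_le_mul_of_nonneg_right (by nlinarith) (sq_nonneg _)
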